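/- Let p be a prime, n ≥ 1 an integer with p > n, and q = p^s for some s ≥ 1. Let F be a finite extension of ℚ_p and 𝒪_F the integral closure of ℤ_p in F, a local ring with maximal ideal 𝔪_F. Suppose M₁, M₂ ∈ Mₙ(𝒪_F) are matrices all of whose entries of M₁ − I and M₂ − I lie in 𝔪_F, and suppose M₂M₁ = M₁^{q+1}M₂ (equivalently, M₂M₁M₂⁻¹ = M₁^{q+1}, both matrices being invertible). Then (M₁^q − I)^n = 0; equivalently, every eigenvalue λ of M₁ in any extension field of F satisfies λ^q = 1. -/

import Mathlib

set_option synthInstance.maxHeartbeats 1000000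
set_option maxHeartbeats 1000000

noncomputable section

/-- The ring of integers of `F`: the integral closure of `ℤ_[p]` in `F`. -/
abbrev RingOfIntegers (p : ℕ) [Fact p.Prime] (F : Type*) [Field F] [Algebra ℤ_[p] F] :=
  integralClosure ℤ_[p] F

theorem exists_pow_sub_pow_eq_mul {p q i j : ℕ} (hp : p.Prime) (hpq : p ∣ q) (hij : i < j)
    (hjp : j - i < p) :
    ∃ m, (q + 1) ^ j = (q + 1) ^ i + q * m ∧ ¬ p ∣ m := by
  have key : ∀ k : ℕ, ∃ t, (q + 1) ^ k = 1 + q * (k + q * t) := by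
    intro k
    induction k with
    | zero => exact ⟨0, by simp⟩
    | succ k ih =>
      obtain ⟨t, ht⟩ := ih
      exact ⟨t + k + q * t, by rw [pow_succ, ht]; ring⟩
  obtain ⟨t, ht⟩ := key (j - i)
  refine ⟨(q + 1) ^ i * ((j - i) + q * t), ?_, ?_⟩
  · rw [← Nat.add_sub_cancel' hij.le, pow_add, Nat.add_sub_cancel' hij.le, ht]
    ring
  · rw [hp.dvd_mul, not_or]
    constructor
    · intro h
      have := (Nat.dvd_add_right hpq).1 (hp.dvd_of_dvd_pow h)
      exact hp.one_lt.ne' (Nat.dvd_one.1 this)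
    · intro h
      have := (Nat.dvd_add_left (hpq.mul_right t)).1 h
      exact absurd (Nat.le_of_dvd (by omega) this) (by omega)

/-- A root of unity of order prime to `p` that reduces to `1` modulo an ideal containing `p`
is equal to `1`. -/
theorem eq_one_of_pow_eq_one_of_sub_one_mem {A : Type*} [CommRing A] [IsDomain A]
    {P : Ideal A} [P.IsPrime] {p m : ℕ} (hp : p.Prime) (hpP : (p : A) ∈ P) (hm : ¬ p ∣ m)
    {x : A} (hx : x - 1 ∈ P) (hxm : x ^ m = 1) : x = 1 := by
  have hgeom : (∑ i ∈ Finset.range m, x ^ i) * (x - 1) = 0 := by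
    rw [geom_sum_mul, hxm, sub_self]
  refine sub_eq_zero.1 ((mul_eq_zero.1 hgeom).resolve_left fun h => ?_)
  have hx' : Ideal.Quotient.mk P x = 1 := by
    rw [← map_one (Ideal.Quotient.mk P)]
    exact Ideal.Quotient.eq.2 hx
  have hmP : (m : A) ∈ P := by
    have := congrArg (Ideal.Quotient.mk P) h
    rw [map_sum] at this
    simp only [map_pow, hx', one_pow, Finset.sum_const, Finset.card_range, nsmul_eq_mul,
      mul_one, map_zero] at this
    rwa [← map_natCast (Ideal.Quotient.mk P), Ideal.Quotient.eq_zero_iff_mem] at this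
  have hcop : IsCoprime (p : ℤ) (m : ℤ) := ((hp.coprime_iff_not_dvd).2 hm).isCoprime
  obtain ⟨a, b, hab⟩ := hcop
  have hab' : (a : A) * p + b * m = 1 := by exact_mod_cast congrArg (Int.cast : ℤ → A) hab
  exact Ideal.IsPrime.one_notMem ‹_›
    (hab' ▸ P.add_mem (P.mul_mem_left _ hpP) (P.mul_mem_left _ hmP))

theorem Matrix.pow_card_eq_zero_of_spectrum_subset {K ι : Type*} [Field K] [IsAlgClosed K]
    [Fintype ι] [DecidableEq ι] (N : Matrix ι ι K) (hN : ∀ a ∈ spectrum K N, a = 0) :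
    N ^ Fintype.card ι = 0 := by
  have hroots : N.charpoly.roots = Multiset.replicate (Fintype.card ι) 0 := by
    rw [Multiset.eq_replicate]
    refine ⟨?_, fun a ha => hN a ?_⟩
    · rw [← (IsAlgClosed.splits N.charpoly).natDegree_eq_card_roots,
        Matrix.charpoly_natDegree_eq_dim]
    · exact Matrix.mem_spectrum_iff_isRoot_charpoly.2 (Polynomial.isRoot_of_mem_roots ha)
  have hchar : N.charpoly = Polynomial.X ^ Fintype.card ι := by
    rw [(IsAlgClosed.splits N.charpoly).eq_prod_roots_of_monic N.charpoly_monic, hroots]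
    simp
  simpa [hchar] using N.aeval_self_charpoly

section LocalRing

variable {R ι : Type*} [CommRing R] [IsLocalRing R] [Fintype ι] [DecidableEq ι]

theorem Matrix.map_residue_eq_one {M : Matrix ι ι R}
    (hM : ∀ i j, (M - 1) i j ∈ IsLocalRing.maximalIdeal R) {S : Type*} [CommRing S]
    (f : R →+* S) (hf : IsLocalRing.maximalIdeal R ≤ RingHom.ker f) : M.map f = 1 := by
  have h : f.mapMatrix (M - 1) = 0 := by
    ext i j
    exact hf (hM i j)
  rw [map_sub, map_one, sub_eq_zero] at h
  exact h

theorem Matrix.isUnit_of_sub_one_mem_maximalIdeal {M : Matrix ι ι R}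
    (hM : ∀ i j, (M - 1) i j ∈ IsLocalRing.maximalIdeal R) : IsUnit M := by
  rw [Matrix.isUnit_iff_isUnit_det]
  apply isUnit_of_map_unit (IsLocalRing.residue R)
  rw [RingHom.map_det, RingHom.mapMatrix_apply,
    Matrix.map_residue_eq_one hM _ IsLocalRing.ker_residue.ge, Matrix.det_one]
  exact isUnit_one

theorem Matrix.sub_one_mem_of_aeval_charpoly_eq_zero {M : Matrix ι ι R}
    (hM : ∀ i j, (M - 1) i j ∈ IsLocalRing.maximalIdeal R) {A : Type*} [CommRing A]
    [Algebra R A] [Algebra.IsIntegral R A] (P : Ideal A) [P.IsMaximal] {x : A}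
    (hx : Polynomial.aeval x M.charpoly = 0) : x - 1 ∈ P := by
  have hP : P.comap (algebraMap R A) = IsLocalRing.maximalIdeal R :=
    IsLocalRing.eq_maximalIdeal (Ideal.isMaximal_comap_of_isIntegral_of_isMaximal P)
  let f : R →+* A ⧸ P := (Ideal.Quotient.mk P).comp (algebraMap R A)
  have hf : IsLocalRing.maximalIdeal R ≤ RingHom.ker f := by
    rw [← hP]
    intro r hr
    exact Ideal.Quotient.eq_zero_iff_mem.2 hr
  have h : Polynomial.eval₂ f (Ideal.Quotient.mk P x) M.charpoly = 0 := by
    rw [← Polynomial.hom_eval₂, ← Polynomial.aeval_def, hx, map_zero]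
  rw [← Polynomial.eval_map, ← Matrix.charpoly_map, Matrix.map_residue_eq_one hM f hf,
    Matrix.charpoly_one] at h
  have h' : Ideal.Quotient.mk P x - 1 = 0 := by
    refine eq_zero_of_pow_eq_zero (n := Fintype.card ι) ?_
    simpa using h
  rwa [← map_one (Ideal.Quotient.mk P), ← map_sub, Ideal.Quotient.eq_zero_iff_mem] at h'

theorem Matrix.pow_eq_one_of_mem_spectrum {K : Type*} [Field K] [Algebra R K]
    {p q : ℕ} (hp : p.Prime) (hpR : (p : R) ∈ IsLocalRing.maximalIdeal R)
    (hpq : p ∣ q) (hιp : Fintype.card ι < p) {M₁ M₂ : Matrix ι ι R}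
    (h₁ : ∀ i j, (M₁ - 1) i j ∈ IsLocalRing.maximalIdeal R)
    (h₂ : ∀ i j, (M₂ - 1) i j ∈ IsLocalRing.maximalIdeal R)
    (hrel : M₂ * M₁ = M₁ ^ (q + 1) * M₂) {a : K}
    (ha : a ∈ spectrum K (M₁.map (algebraMap R K))) : a ^ q = 1 := by
  set N := M₁.map (algebraMap R K) with hN
  have hstep : ∀ b ∈ spectrum K N, b ^ (q + 1) ∈ spectrum K N := by
    intro b hb
    obtain ⟨u, hu⟩ := (Matrix.isUnit_of_sub_one_mem_maximalIdeal h₂).map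
      (algebraMap R K).mapMatrix
    have hrel' : (u : Matrix ι ι K) * N = N ^ (q + 1) * u := by
      have := congrArg (algebraMap R K).mapMatrix hrel
      rwa [map_mul, map_mul, map_pow, ← hu] at this
    have hconj : N ^ (q + 1) = u * N * (u⁻¹ : (Matrix ι ι K)ˣ) := by
      rw [hrel', Units.mul_inv_cancel_right]
    have := spectrum.pow_mem_pow N (q + 1) hb
    rwa [hconj, spectrum.units_conjugate] at this
  have hiter : ∀ i : ℕ, a ^ (q + 1) ^ i ∈ spectrum K N := by
    intro i
    induction i with
    | zero => simpa using ha
    | succ i ih => rw [pow_succ, pow_mul]; exact hstep _ ih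
  have hroot : ∀ b ∈ spectrum K N, N.charpoly.IsRoot b := fun b hb =>
    Matrix.mem_spectrum_iff_isRoot_charpoly.1 hb
  classical
  obtain ⟨i, hi, j, hj, hij, hpow⟩ : ∃ i ∈ Finset.range (Fintype.card ι + 1),
      ∃ j ∈ Finset.range (Fintype.card ι + 1), i ≠ j ∧ a ^ (q + 1) ^ i = a ^ (q + 1) ^ j := by
    refine Finset.exists_ne_map_eq_of_card_lt_of_maps_to (t := N.charpoly.roots.toFinset) ?_ ?_
    · rw [Finset.card_range, Nat.lt_succ_iff]
      refine (Multiset.toFinset_card_le _).trans ((Polynomial.card_roots' _).trans ?_)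
      rw [Matrix.charpoly_natDegree_eq_dim]
    · intro i _
      simpa [N.charpoly_monic.ne_zero] using hroot _ (hiter i)
  wlog hlt : i < j generalizing i j
  · exact this j hj i hi hij.symm hpow.symm (lt_of_le_of_ne (not_lt.1 hlt) hij.symm)
  rw [Finset.mem_range] at hi hj
  obtain ⟨m, hm, hpm⟩ := exists_pow_sub_pow_eq_mul hp hpq hlt (by omega)
  have ha0 : a ≠ 0 := by
    rintro rfl
    refine spectrum.zero_notMem K ?_ ha
    exact (Matrix.isUnit_of_sub_one_mem_maximalIdeal h₁).map (algebraMap R K).mapMatrix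
  have ham : (a ^ q) ^ m = 1 := by
    rw [hm, pow_add] at hpow
    rw [← pow_mul]
    exact mul_left_cancel₀ (pow_ne_zero _ ha0) (hpow.symm.trans (mul_one _).symm)
  have hroot' : Polynomial.aeval a M₁.charpoly = 0 := by
    have := hroot a ha
    rwa [hN, Matrix.charpoly_map, Polynomial.IsRoot, Polynomial.eval_map_algebraMap] at this
  let A := integralClosure R K
  let x : A := ⟨a, M₁.charpoly, M₁.charpoly_monic, hroot'⟩
  have hx : Polynomial.aeval x M₁.charpoly = 0 :=
    Subtype.ext ((Polynomial.aeval_algebraMap_apply K x M₁.charpoly).symm.trans hroot')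
  obtain ⟨P, hP⟩ := Ideal.exists_maximal A
  have hx1 := Matrix.sub_one_mem_of_aeval_charpoly_eq_zero h₁ P hx
  have hPR : P.comap (algebraMap R A) = IsLocalRing.maximalIdeal R :=
    IsLocalRing.eq_maximalIdeal (Ideal.isMaximal_comap_of_isIntegral_of_isMaximal P)
  have hpP : (p : A) ∈ P := by
    rw [← hPR, Ideal.mem_comap, map_natCast] at hpR
    exact hpR
  have hxq : x ^ q = 1 := by
    refine eq_one_of_pow_eq_one_of_sub_one_mem hp hpP hpm ?_ (Subtype.ext ham)
    exact P.mem_of_dvd (sub_one_dvd_pow_sub_one x q) hx1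
  exact congrArg Subtype.val hxq

end LocalRing

theorem natCast_mem_maximalIdeal_ringOfIntegers (p : ℕ) [Fact p.Prime] (F : Type*) [Field F]
    [Algebra ℤ_[p] F] [IsLocalRing (RingOfIntegers p F)] :
    (p : RingOfIntegers p F) ∈ IsLocalRing.maximalIdeal (RingOfIntegers p F) := by
  have h : (IsLocalRing.maximalIdeal (RingOfIntegers p F)).comap
      (algebraMap ℤ_[p] (RingOfIntegers p F)) = IsLocalRing.maximalIdeal ℤ_[p] :=
    IsLocalRing.eq_maximalIdeal (Ideal.isMaximal_comap_of_isIntegral_of_isMaximal _)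
  have hp : (p : ℤ_[p]) ∈ IsLocalRing.maximalIdeal ℤ_[p] := by
    rw [PadicInt.maximalIdeal_eq_span_p]
    exact Ideal.mem_span_singleton_self _
  rwa [← h, Ideal.mem_comap, map_natCast] at hp

/-- If `M₁, M₂` are matrices over `𝒪_F` congruent to the identity modulo the maximal ideal
and `M₂ M₁ M₂⁻¹ = M₁^{q+1}` (with `q = p^s`, `p > n`), then `(M₁^q − I)^n = 0`, i.e. every
eigenvalue `λ` of `M₁` satisfies `λ^q = 1`. -/
theorem eigenvalues_are_qth_roots_of_unity
    (p s q n : ℕ) (hn : 1 ≤ n) (hpn : n < p) (hs : 1 ≤ s) (hq : q = p ^ s) [Fact p.Prime]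
    (F : Type) [Field F] [Algebra ℚ_[p] F] [FiniteDimensional ℚ_[p] F]
    [Algebra ℤ_[p] F] [IsScalarTower ℤ_[p] ℚ_[p] F]
    [IsLocalRing (RingOfIntegers p F)]
    (M₁ M₂ : Matrix (Fin n) (Fin n) (RingOfIntegers p F))
    (h₁ : ∀ i j : Fin n, (M₁ - 1) i j ∈ IsLocalRing.maximalIdeal (RingOfIntegers p F))
    (h₂ : ∀ i j : Fin n, (M₂ - 1) i j ∈ IsLocalRing.maximalIdeal (RingOfIntegers p F))
    (hrel : M₂ * M₁ = M₁ ^ (q + 1) * M₂) :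
    (M₁ ^ q - 1) ^ n = 0 := by
  let K := AlgebraicClosure F
  let f : RingOfIntegers p F →+* K := algebraMap (RingOfIntegers p F) K
  have hf : Function.Injective f :=
    (algebraMap F K).injective.comp Subtype.val_injective
  have hpq : p ∣ q := hq ▸ dvd_pow_self p (by omega)
  have hspec : ∀ a ∈ spectrum K ((M₁.map f) ^ q - 1), a = 0 := by
    intro a ha
    have hX : (M₁.map f) ^ q - 1
        = Polynomial.aeval (M₁.map f) (Polynomial.X ^ q - 1 : Polynomial K) := by simp
    have : Nonempty (Fin n) := ⟨⟨0, hn⟩⟩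
    rw [hX, spectrum.map_polynomial_aeval_of_nonempty _ _
      (spectrum.nonempty_of_isAlgClosed_of_finiteDimensional K _)] at ha
    obtain ⟨b, hb, rfl⟩ := ha
    have := Matrix.pow_eq_one_of_mem_spectrum Fact.out
      (natCast_mem_maximalIdeal_ringOfIntegers p F) hpq (by simpa using hpn) h₁ h₂ hrel hb
    simp [this]
  have hzero := Matrix.pow_card_eq_zero_of_spectrum_subset _ hspec
  rw [Fintype.card_fin] at hzero
  refine Matrix.map_injective hf ?_
  change f.mapMatrix ((M₁ ^ q - 1) ^ n) = f.mapMatrix 0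
  rw [map_pow, map_sub, map_pow, map_one, map_zero]
  exact hzero
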